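/- arXiv:2006.03529 — 3 statements merged into one kernel-verified Lean document; each statement's English description precedes it below -/
import Mathlib

section
/- If H is a 1D spin Hamiltonian, then its language L_H is a context-free language (indeed it is accepted by a deterministic pushdown automaton). -/
/-- The finite alphabet of the language: Σ_q ∪ [p] ∪ auxiliary symbols. -/
inductive Symb (q p : ℕ) : Type where
  | spin (s : Fin q)      -- a spin symbol from Σ_q
  | ham (α : Fin p)       -- a local-Hamiltonian label from [p]
  | lhd                   -- ◁
  | rhd                   -- ▷
  | sq                    -- □
  | dia                   -- ◇
  | tri                   -- ▲
  | blank                 -- ␣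
  | comp                  -- ∘
  | bullet                -- •
  deriving DecidableEq, Fintype

/-- A local interaction `I = (α, A)`: a label `α ∈ [p]` together with a tuple of `k`
addresses, each an integer or the missing-spin symbol ▲ (modelled as `none`). -/
abbrev LocInt (k p : ℕ) := Fin p × (Fin k → Option ℤ)

/-- A configuration `(s_1, I_1, …, s_n, I_n)` (positions are 0-based here). -/
abbrev Config (q k p : ℕ) := List (Fin q × LocInt k p)

/-- The spin addressed by address `a` relative to (0-based) position `j`:
it is `▲` (`none`) whenever `a = ▲` or the addressed position lies outside `[n]`. -/
def spinAt {q k p : ℕ} (x : Config q k p) (j : ℕ) : Option ℤ → Option (Fin q)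
  | none => none
  | some l =>
      if 0 ≤ (j : ℤ) + l then (x[((j : ℤ) + l).toNat]?).map Prod.fst else none

/-- `H(s_1,I_1,…,s_n,I_n) = Σ_{j=1}^n h_{α_j}((s_{j+l})_{l ∈ A_j})`. -/
def energy {q k p : ℕ} (h : Fin p → (Fin k → Option (Fin q)) → ℤ)
    (x : Config q k p) : ℤ :=
  ∑ j : Fin x.length, h (x.get j).2.1 (fun l => spinAt x (j : ℕ) ((x.get j).2.2 l))

/-- The unary encoding `u : ℤ → {◇,□}*`. -/
def unary {q p : ℕ} (z : ℤ) : List (Symb q p) :=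
  if 0 ≤ z then List.replicate z.toNat Symb.dia else List.replicate (-z).toNat Symb.sq

/-- Encoding of an address: `u(a)` for an integer `a`, and `▲` for the missing-spin symbol. -/
def encAddr {q p : ℕ} : Option ℤ → List (Symb q p)
  | none => [Symb.tri]
  | some z => unary z

/-- `γ(α, (a_1,…,a_k)) = α ◁ u(a_1) ␣ ⋯ ␣ u(a_k) ▷`. -/
def encInt {q k p : ℕ} (I : LocInt k p) : List (Symb q p) :=
  [Symb.ham I.1, Symb.lhd] ++
    List.intercalate [Symb.blank] (List.ofFn fun l => encAddr (I.2 l)) ++ [Symb.rhd]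

/-- `e(s_1,I_1,…,s_n,I_n) = s_1 γ(I_1) ⋯ s_n γ(I_n)`. -/
def encConfig {q k p : ℕ} (x : Config q k p) : List (Symb q p) :=
  (x.map fun si => Symb.spin si.1 :: encInt si.2).flatten

/-- The language of the spin Hamiltonian, `L_H = { e(x) ∘ u(H(x)) • : x ∈ 𝒟 }`. -/
def langH {q k p : ℕ} (h : Fin p → (Fin k → Option (Fin q)) → ℤ)
    (D : Set (Config q k p)) : Language (Symb q p) :=
  {w | ∃ x ∈ D, w = encConfig x ++ [Symb.comp] ++ unary (energy h x) ++ [Symb.bullet]}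

/-- `𝓘_{1D} ⊆ [p] × {−k,…,k}^k` and nonempty: each address is an integer in `{−k,…,k}`. -/
def Is1DIntSet {k p : ℕ} (S : Set (LocInt k p)) : Prop :=
  S.Nonempty ∧ ∀ I ∈ S, ∀ l : Fin k, ∃ a : ℤ, I.2 l = some a ∧ -(k : ℤ) ≤ a ∧ a ≤ k

/-- The domain of a 1D spin Hamiltonian with constant interaction set `S = 𝓘_{1D}`:
all configurations of any length `n ≥ 1` with all local interactions drawn from `S`. -/
def Domain1D {k p : ℕ} (q : ℕ) (S : Set (LocInt k p)) : Set (Config q k p) :=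
  {x | x ≠ [] ∧ ∀ j : Fin x.length, (x.get j).2 ∈ S}

namespace ContextFreeGrammar

variable {T : Type*}

/-- The product of the languages assigned by `sem` to the symbols of a sentential form. -/
def formLanguage {N : Type*} (sem : N → Language T) (u : List (Symbol T N)) : Language T :=
  (u.map fun a => match a with
    | .terminal t => ({[t]} : Language T)
    | .nonterminal A => sem A).prod

@[simp] lemma formLanguage_nil {N : Type*} (sem : N → Language T) :
    formLanguage sem [] = 1 := rfl

@[simp] lemma formLanguage_terminal_cons {N : Type*} (sem : N → Language T) (t : T)
    (u : List (Symbol T N)) :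
    formLanguage sem (.terminal t :: u) = ({[t]} : Language T) * formLanguage sem u := by
  simp [formLanguage]

@[simp] lemma formLanguage_nonterminal_cons {N : Type*} (sem : N → Language T) (A : N)
    (u : List (Symbol T N)) :
    formLanguage sem (.nonterminal A :: u) = sem A * formLanguage sem u := by
  simp [formLanguage]

lemma formLanguage_append {N : Type*} (sem : N → Language T) (u v : List (Symbol T N)) :
    formLanguage sem (u ++ v) = formLanguage sem u * formLanguage sem v := by
  simp [formLanguage]

lemma mem_formLanguage_map_terminal {N : Type*} (sem : N → Language T) (w y : List T) :
    y ∈ formLanguage sem (w.map .terminal) ↔ y = w := by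
  induction w generalizing y with
  | nil => simp [Language.mem_one]
  | cons t w ih =>
    rw [List.map_cons, formLanguage_terminal_cons, Language.mem_mul]
    constructor
    · rintro ⟨a, ha, b, hb, rfl⟩
      rw [ih] at hb
      obtain rfl : a = [t] := ha
      simp [hb]
    · rintro rfl
      exact ⟨[t], rfl, w, (ih w).2 rfl, rfl⟩

/-- Languages assigned to the nonterminals and closed under the rules bound the grammar. -/
lemma language_le_of_rules (g : ContextFreeGrammar T) (sem : g.NT → Language T)
    (hsem : ∀ r ∈ g.rules, formLanguage sem r.output ≤ sem r.input) :
    g.language ≤ sem g.initial := by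
  have key : ∀ u v, g.Derives u v → formLanguage sem v ≤ formLanguage sem u := by
    intro u v huv
    induction huv with
    | refl => exact le_rfl
    | tail _ hp ih =>
      obtain ⟨r, hr, hrw⟩ := hp
      obtain ⟨a, b, rfl, rfl⟩ := hrw.exists_parts
      refine le_trans ?_ ih
      simp only [formLanguage_append, formLanguage_nonterminal_cons, formLanguage_nil, mul_one]
      exact mul_le_mul' (mul_le_mul' le_rfl (hsem r hr)) le_rfl
  intro w hw
  have := key _ _ hw ((mem_formLanguage_map_terminal sem w w).2 rfl)
  simpa using this

lemma Derives.append {g : ContextFreeGrammar T} {u u' v v' : List (Symbol T g.NT)}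
    (hu : g.Derives u u') (hv : g.Derives v v') : g.Derives (u ++ v) (u' ++ v') :=
  (hu.append_right v).trans (hv.append_left u')

lemma Derives.of_rule {g : ContextFreeGrammar T} {A : g.NT} {u v : List (Symbol T g.NT)}
    (hr : ⟨A, u⟩ ∈ g.rules) (huv : g.Derives u v) : g.Derives [.nonterminal A] v :=
  Produces.trans_derives ⟨_, hr, ContextFreeRule.Rewrites.input_output⟩ huv

end ContextFreeGrammar

namespace WeightedAutomaton

variable {T Q : Type*}

/-- `Run Δ n s w z t`: there is a run of `n` transitions from `s` to `t` which reads `w` and has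
total weight `z`. -/
inductive Run (Δ : Set (Q × List T × ℤ × Q)) : ℕ → Q → List T → ℤ → Q → Prop
  | nil (s : Q) : Run Δ 0 s [] 0 s
  | cons {n : ℕ} {s r t : Q} {v w : List T} {y z : ℤ} (hstep : (s, v, y, r) ∈ Δ)
      (hrun : Run Δ n r w z t) : Run Δ (n + 1) s (v ++ w) (y + z) t

variable {Δ : Set (Q × List T × ℤ × Q)}

lemma Run.append {m n : ℕ} {s r t : Q} {v w : List T} {y z : ℤ} (h₁ : Run Δ m s v y r)
    (h₂ : Run Δ n r w z t) : Run Δ (m + n) s (v ++ w) (y + z) t := by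
  induction h₁ with
  | nil => simpa using h₂
  | cons hstep _ ih =>
    have := Run.cons hstep (ih h₂)
    rw [List.append_assoc]
    convert this using 1 <;> ring

lemma Run.weight_eq_zero {s t : Q} {w : List T} {z : ℤ} (h : Run Δ 0 s w z t) : z = 0 := by
  cases h
  rfl

/-- A run whose signed weight exceeds `a ≥ 0` can be split right after it first does so. -/
lemma Run.exists_split {M : ℤ} (hM : ∀ τ ∈ Δ, |τ.2.2.1| ≤ M) (ε : ℤˣ) {n : ℕ} {s t : Q}
    {w : List T} {z : ℤ} (h : Run Δ n s w z t) {a : ℤ} (ha : 0 ≤ a) (haz : a < ε * z) :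
    ∃ (n₁ n₂ : ℕ) (w₁ w₂ : List T) (z₁ z₂ : ℤ) (r : Q), n = n₁ + n₂ ∧ w = w₁ ++ w₂ ∧
      z = z₁ + z₂ ∧ Run Δ n₁ s w₁ z₁ r ∧ Run Δ n₂ r w₂ z₂ t ∧ a < ε * z₁ ∧ ε * z₁ ≤ a + M := by
  induction h generalizing a with
  | nil => simp at haz; omega
  | @cons n s r t v w y z hstep hrun ih =>
    have hy : ε * y ≤ M := by
      have h₁ := hM _ hstep
      rw [abs_le] at h₁
      rcases Int.units_eq_one_or ε with rfl | rfl <;> push_cast <;> linarith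
    by_cases hay : a < ε * y
    · refine ⟨1, n, v, w, y, z, r, by omega, rfl, rfl, ?_, hrun, hay, by linarith⟩
      simpa using Run.cons hstep (Run.nil r)
    · obtain ⟨n₁, n₂, w₁, w₂, z₁, z₂, r', rfl, rfl, rfl, h₁, h₂, hlt, hle⟩ :=
        ih (a := a - ε * y) (by linarith) (by rw [mul_add] at haz; linarith)
      refine ⟨n₁ + 1, n₂, v ++ w₁, w₂, y + z₁, z₂, r', by omega, by simp, by ring,
        Run.cons hstep h₁, h₂, ?_, ?_⟩ <;> rw [mul_add] <;> linarith

/-- The words read by accepting runs, each followed by the separator `m`, the weight of the run in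
unary, written with the digit `c ε` for the sign `ε`, and the end marker `e`. -/
def weightLanguage (Δ : Set (Q × List T × ℤ × Q)) (I F : Set Q) (c : ℤˣ → T) (m e : T) :
    Language T :=
  {x | ∃ s ∈ I, ∃ t ∈ F, ∃ (k : ℕ) (w : List T) (ε : ℤˣ) (n : ℕ),
    Run Δ k s w (ε * n) t ∧ x = w ++ [m] ++ List.replicate n (c ε) ++ [e]}

/-- Nonterminals of the grammar for `weightLanguage`: `bal s t d` generates words read by runs from
`s` to `t` of weight `d`, and `out ε s` generates words read by runs from `s` to a final state of
weight of sign `ε`, followed by the separator and the weight. -/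
inductive Nonterminal (Q : Type) : Type
  | start
  | bal (s t : Q) (d : ℤ)
  | out (ε : ℤˣ) (s : Q)

section Grammar

variable {T : Type*} {Q : Type}

/-- The rules of the grammar for `weightLanguage`; intermediate weights are bounded by `N`. -/
inductive IsRule (Δ : Set (Q × List T × ℤ × Q)) (I F : Set Q) (c : ℤˣ → T) (m e : T) (N : ℕ) :
    ContextFreeRule T (Nonterminal Q) → Prop
  | start (ε : ℤˣ) (s : Q) (hs : s ∈ I) :
      IsRule Δ I F c m e N ⟨.start, [.nonterminal (.out ε s)] ++ [.terminal e]⟩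
  | out (ε : ℤˣ) (s t : Q) (n : ℕ) (hn : n ≤ N) :
      IsRule Δ I F c m e N ⟨.out ε s, [.nonterminal (.bal s t (ε * n))] ++
        ([.nonterminal (.out ε t)] ++ (List.replicate n (c ε)).map .terminal)⟩
  | accept (ε : ℤˣ) (t : Q) (ht : t ∈ F) : IsRule Δ I F c m e N ⟨.out ε t, [.terminal m]⟩
  | nil (s : Q) : IsRule Δ I F c m e N ⟨.bal s s 0, []⟩
  | step (s t : Q) (v : List T) (z : ℤ) (h : (s, v, z, t) ∈ Δ) :
      IsRule Δ I F c m e N ⟨.bal s t z, v.map .terminal⟩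
  | comp (s r t : Q) (y z : ℤ) (hy : |y| ≤ N) (hz : |z| ≤ N) :
      IsRule Δ I F c m e N
        ⟨.bal s t (y + z), [.nonterminal (.bal s r y)] ++ [.nonterminal (.bal r t z)]⟩

lemma finite_isRule [Finite Q] {Δ : Set (Q × List T × ℤ × Q)} (hΔ : Δ.Finite) (I F : Set Q)
    (c : ℤˣ → T) (m e : T) (N : ℕ) : {r | IsRule Δ I F c m e N r}.Finite := by
  have hN : (Set.Icc (-(N : ℤ)) N).Finite := Set.finite_Icc _ _
  have h₁ := Set.finite_range fun x : ℤˣ × Q =>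
    (⟨.start, [.nonterminal (.out x.1 x.2)] ++ [.terminal e]⟩ : ContextFreeRule T (Nonterminal Q))
  have h₂ := Set.finite_range fun x : ℤˣ × Q × Q × Fin (N + 1) =>
    (⟨.out x.1 x.2.1, [.nonterminal (.bal x.2.1 x.2.2.1 (x.1 * (x.2.2.2 : ℕ)))] ++
      ([.nonterminal (.out x.1 x.2.2.1)] ++
        (List.replicate x.2.2.2 (c x.1)).map .terminal)⟩ : ContextFreeRule T (Nonterminal Q))
  have h₃ := Set.finite_range fun x : ℤˣ × Q =>
    (⟨.out x.1 x.2, [.terminal m]⟩ : ContextFreeRule T (Nonterminal Q))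
  have h₄ := Set.finite_range fun s : Q => (⟨.bal s s 0, []⟩ : ContextFreeRule T (Nonterminal Q))
  have h₅ := hΔ.image fun x =>
    (⟨.bal x.1 x.2.2.2 x.2.2.1, x.2.1.map .terminal⟩ : ContextFreeRule T (Nonterminal Q))
  have h₆ := ((Set.finite_univ (α := Q × Q × Q)).prod (hN.prod hN)).image fun x =>
    (⟨.bal x.1.1 x.1.2.2 (x.2.1 + x.2.2), [.nonterminal (.bal x.1.1 x.1.2.1 x.2.1)] ++
      [.nonterminal (.bal x.1.2.1 x.1.2.2 x.2.2)]⟩ : ContextFreeRule T (Nonterminal Q))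
  refine (h₁.union (h₂.union (h₃.union (h₄.union (h₅.union h₆))))).subset ?_
  rintro _ (⟨ε, s, -⟩ | ⟨ε, s, t, n, hn⟩ | ⟨ε, t, -⟩ | ⟨s⟩ | ⟨s, t, v, z, h⟩ |
    ⟨s, r, t, y, z, hy, hz⟩)
  · exact .inl ⟨(ε, s), rfl⟩
  · exact .inr (.inl ⟨(ε, s, t, ⟨n, by omega⟩), rfl⟩)
  · exact .inr (.inr (.inl ⟨(ε, t), rfl⟩))
  · exact .inr (.inr (.inr (.inl ⟨s, rfl⟩)))
  · exact .inr (.inr (.inr (.inr (.inl ⟨_, h, rfl⟩))))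
  · exact .inr (.inr (.inr (.inr (.inr
      ⟨((s, r, t), (y, z)), ⟨trivial, abs_le.1 hy, abs_le.1 hz⟩, rfl⟩))))

/-- The grammar generating `weightLanguage`. -/
noncomputable def grammar [Finite Q] {Δ : Set (Q × List T × ℤ × Q)} (hΔ : Δ.Finite) (I F : Set Q)
    (c : ℤˣ → T) (m e : T) (N : ℕ) : ContextFreeGrammar T where
  NT := Nonterminal Q
  initial := .start
  rules := (finite_isRule hΔ I F c m e N).toFinset

/-- The language generated by each nonterminal of `grammar`. -/
def ntLanguage (Δ : Set (Q × List T × ℤ × Q)) (I F : Set Q) (c : ℤˣ → T) (m e : T) :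
    Nonterminal Q → Language T
  | .start => weightLanguage Δ I F c m e
  | .bal s t d => {w | ∃ k, Run Δ k s w d t}
  | .out ε s => {x | ∃ t ∈ F, ∃ (k : ℕ) (w : List T) (n : ℕ),
      Run Δ k s w (ε * n) t ∧ x = w ++ [m] ++ List.replicate n (c ε)}

open ContextFreeGrammar

variable {Δ : Set (Q × List T × ℤ × Q)} {I F : Set Q} {c : ℤˣ → T} {m e : T} {N : ℕ}

lemma IsRule.formLanguage_le {r : ContextFreeRule T (Nonterminal Q)}
    (hr : IsRule Δ I F c m e N r) :
    formLanguage (ntLanguage Δ I F c m e) r.output ≤ ntLanguage Δ I F c m e r.input := by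
  rcases hr with ⟨ε, s, hs⟩ | ⟨ε, s, t, n, hn⟩ | ⟨ε, t, ht⟩ | ⟨s⟩ |
    ⟨s, t, v, z, h⟩ | ⟨s, r, t, y, z, hy, hz⟩ <;>
  intro x hx
  · simp only [formLanguage_append, formLanguage_nonterminal_cons, formLanguage_terminal_cons,
      formLanguage_nil, mul_one] at hx
    obtain ⟨_, ⟨t, ht, k, w, n, hrun, rfl⟩, b, hb, rfl⟩ := hx
    obtain rfl : b = [e] := hb
    exact ⟨s, hs, t, ht, k, w, ε, n, hrun, rfl⟩
  · simp only [formLanguage_append, formLanguage_nonterminal_cons,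
      formLanguage_nil, mul_one] at hx
    obtain ⟨w₁, ⟨k₁, h₁⟩, _, ⟨_, ⟨f, hf, k, w, n', hrun, rfl⟩, b, hb, rfl⟩, rfl⟩ := hx
    obtain rfl := (mem_formLanguage_map_terminal _ _ _).1 hb
    refine ⟨f, hf, k₁ + k, w₁ ++ w, n' + n, ?_, ?_⟩
    · have := h₁.append hrun
      rwa [← mul_add, ← Nat.cast_add, add_comm n n'] at this
    · simp
  · simp only [formLanguage_terminal_cons, formLanguage_nil, mul_one] at hx
    obtain rfl : x = [m] := hx
    exact ⟨t, ht, 0, [], 0, by simpa using Run.nil t, rfl⟩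
  · obtain rfl : x = [] := hx
    exact ⟨0, Run.nil s⟩
  · obtain rfl := (mem_formLanguage_map_terminal _ _ _).1 hx
    exact ⟨1, by simpa using Run.cons h (Run.nil t)⟩
  · simp only [formLanguage_append, formLanguage_nonterminal_cons,
      formLanguage_nil, mul_one] at hx
    obtain ⟨w₁, ⟨k₁, h₁⟩, w₂, ⟨k₂, h₂⟩, rfl⟩ := hx
    exact ⟨_, h₁.append h₂⟩

variable [Finite Q] {hΔ : Δ.Finite}

lemma mem_grammar_rules {r : ContextFreeRule T (Nonterminal Q)} :
    r ∈ (grammar hΔ I F c m e N).rules ↔ IsRule Δ I F c m e N r :=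
  Set.Finite.mem_toFinset _

lemma grammar_language_le : (grammar hΔ I F c m e N).language ≤ weightLanguage Δ I F c m e :=
  language_le_of_rules (grammar hΔ I F c m e N) (ntLanguage Δ I F c m e) fun _ hr =>
    (mem_grammar_rules.1 hr).formLanguage_le

lemma Run.derives_bal {M : ℕ} (hM : ∀ τ ∈ Δ, |τ.2.2.1| ≤ M) (hM₀ : 0 < M) {n : ℕ} {s t : Q}
    {w : List T} {z : ℤ} (h : Run Δ n s w z t) (hz : |z| ≤ (2 * M : ℕ)) :
    (grammar hΔ I F c m e (2 * M)).Derives [.nonterminal (.bal s t z)] (w.map .terminal) := by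
  induction n using Nat.strong_induction_on generalizing s t w z with
  | _ n ih =>
  have comp : ∀ {r : Q} {k₁ k₂ : ℕ} {w₁ w₂ : List T} {z₁ z₂ : ℤ}, Run Δ k₁ s w₁ z₁ r →
      Run Δ k₂ r w₂ z₂ t → k₁ < n → k₂ < n → |z₁| ≤ (2 * M : ℕ) → |z₂| ≤ (2 * M : ℕ) →
      (grammar hΔ I F c m e (2 * M)).Derives [.nonterminal (.bal s t (z₁ + z₂))]
        ((w₁ ++ w₂).map .terminal) := by
    intro r k₁ k₂ w₁ w₂ z₁ z₂ h₁ h₂ hk₁ hk₂ hz₁ hz₂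
    rw [List.map_append]
    exact .of_rule (mem_grammar_rules.2 (.comp s r t z₁ z₂ hz₁ hz₂))
      ((ih _ hk₁ h₁ hz₁).append (ih _ hk₂ h₂ hz₂))
  cases h with
  | nil => exact .of_rule (mem_grammar_rules.2 (.nil s)) (.refl _)
  | @cons n _ r _ v w y z hstep hrun =>
    have hy := hM _ hstep
    simp only at hy
    by_cases hz' : |z| ≤ (2 * M : ℕ)
    · rw [List.map_append]
      exact .of_rule (mem_grammar_rules.2 (.comp s r t y z (by push_cast; omega) hz'))
        (Derives.append (.of_rule (mem_grammar_rules.2 (.step s r v y hstep)) (.refl _))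
          (ih n (by omega) hrun hz'))
    · obtain ⟨ε, hε⟩ : ∃ ε : ℤˣ, ε * z = |z| := by
        rcases le_total 0 z with h | h
        · exact ⟨1, by simp [abs_of_nonneg h]⟩
        · exact ⟨-1, by simp [abs_of_nonpos h]⟩
      obtain ⟨n₁, n₂, w₁, w₂, z₁, z₂, r', rfl, rfl, rfl, h₁, h₂, hlt, hle⟩ :=
        hrun.exists_split hM ε (a := |z| - 2 * M) (by push_cast at hz'; omega)
          (by omega)
      have hn₂ : 0 < n₂ := by
        rcases Nat.eq_zero_or_pos n₂ with rfl | hpos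
        · rw [h₂.weight_eq_zero, add_zero] at hε hle
          omega
        · exact hpos
      rw [← List.append_assoc, ← add_assoc]
      push_cast at hz hz'
      rw [abs_le] at hz hy
      refine comp (Run.cons hstep h₁) h₂ (by omega) (by omega) ?_ ?_ <;>
        rw [abs_le] <;> push_cast <;>
        rcases Int.units_eq_one_or ε with rfl | rfl <;> simp at hε hle hlt <;>
        constructor <;> omega

lemma Run.derives_out {M : ℕ} (hM : ∀ τ ∈ Δ, |τ.2.2.1| ≤ M) (hM₀ : 0 < M) {k n : ℕ} {s t : Q}
    {w : List T} {ε : ℤˣ} (h : Run Δ k s w (ε * n) t) (ht : t ∈ F) :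
    (grammar hΔ I F c m e (2 * M)).Derives [.nonterminal (.out ε s)]
      ((w ++ [m] ++ List.replicate n (c ε)).map .terminal) := by
  have hε : (ε : ℤ) * ε = 1 := Int.units_coe_mul_self ε
  induction k using Nat.strong_induction_on generalizing s w n with
  | _ k ih =>
  by_cases hn : n ≤ 2 * M
  · rw [List.append_assoc, List.map_append, List.map_append]
    refine .of_rule (mem_grammar_rules.2 (.out ε s t n hn)) (Derives.append
      (h.derives_bal hM hM₀ ?_) (Derives.append
        (.of_rule (mem_grammar_rules.2 (.accept ε t ht)) (.refl _)) (.refl _)))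
    rcases Int.units_eq_one_or ε with rfl | rfl <;> simp <;> omega
  · obtain ⟨k₁, k₂, w₁, w₂, z₁, z₂, r, rfl, rfl, hz, h₁, h₂, hlt, hle⟩ :=
      h.exists_split hM ε le_rfl (by rw [← mul_assoc, hε]; omega)
    have hk₁ : 0 < k₁ := by
      rcases Nat.eq_zero_or_pos k₁ with rfl | hpos
      · simp [h₁.weight_eq_zero] at hlt
      · exact hpos
    have hsum : (n : ℤ) = ε * z₁ + ε * z₂ := by rw [← mul_add, ← hz, ← mul_assoc, hε, one_mul]
    obtain ⟨n₁, hn₁⟩ := Int.eq_ofNat_of_zero_le hlt.le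
    obtain ⟨n₂, hn₂⟩ := Int.eq_ofNat_of_zero_le (a := ε * z₂) (by omega)
    obtain rfl : z₁ = ε * n₁ := by rw [← hn₁, ← mul_assoc, hε, one_mul]
    obtain rfl : z₂ = ε * n₂ := by rw [← hn₂, ← mul_assoc, hε, one_mul]
    obtain rfl : n = n₂ + n₁ := by omega
    rw [List.replicate_add, List.append_assoc, List.append_assoc, List.map_append,
      ← List.append_assoc [m], ← List.append_assoc w₂, ← List.append_assoc w₂, List.map_append]
    exact .of_rule (mem_grammar_rules.2 (.out ε s r n₁ (by omega))) (Derives.append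
      (h₁.derives_bal hM hM₀ (by rcases Int.units_eq_one_or ε with rfl | rfl <;> simp <;> omega))
      (Derives.append (ih k₂ (by omega) h₂) (.refl _)))

theorem isContextFree_weightLanguage (hΔ : Δ.Finite) (I F : Set Q) (c : ℤˣ → T) (m e : T) :
    (weightLanguage Δ I F c m e).IsContextFree := by
  obtain ⟨M, hM₀, hM⟩ : ∃ M : ℕ, 0 < M ∧ ∀ τ ∈ Δ, |τ.2.2.1| ≤ (M : ℤ) := by
    obtain ⟨B, hB⟩ := (hΔ.image fun τ => |τ.2.2.1|).bddAbove
    refine ⟨B.toNat + 1, by omega, fun τ hτ => ?_⟩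
    have := hB ⟨τ, hτ, rfl⟩
    simp only at this
    omega
  refine ⟨grammar hΔ I F c m e (2 * M), le_antisymm grammar_language_le ?_⟩
  rintro _ ⟨s, hs, t, ht, k, w, ε, n, hrun, rfl⟩
  change ContextFreeGrammar.Derives _ _ _
  rw [List.map_append]
  exact .of_rule (mem_grammar_rules.2 (.start ε s hs))
    ((hrun.derives_out hM hM₀ ht).append (.refl _))

end Grammar

end WeightedAutomaton

section OneD

open WeightedAutomaton

variable {q k p : ℕ}

/-- The spins at the positions `-k, …, k` of a bi-infinite chain with missing spins. -/
def spinWindow (k : ℕ) (f : ℤ → Option (Fin q)) : Set.Icc (-(k : ℤ)) k → Option (Fin q) :=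
  fun l => f l

/-- The transitions of the automaton reading a configuration: the states are the windows around
the current position, and the weight is the local energy at this position. -/
def spinStep (h : Fin p → (Fin k → Option (Fin q)) → ℤ) (S : Set (LocInt k p)) :
    Set ((Set.Icc (-(k : ℤ)) k → Option (Fin q)) × List (Symb q p) × ℤ ×
      (Set.Icc (-(k : ℤ)) k → Option (Fin q))) :=
  {τ | ∃ (f : ℤ → Option (Fin q)) (s : Fin q), ∃ I ∈ S, f 0 = some s ∧
    τ = (spinWindow k f, Symb.spin s :: encInt I, h I.1 fun l => (I.2 l).bind f,
      spinWindow k fun i => f (i + 1))}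

/-- The energy of a configuration embedded at the nonnegative positions of the chain `f`. -/
def chainEnergy (h : Fin p → (Fin k → Option (Fin q)) → ℤ) (f : ℤ → Option (Fin q)) :
    Config q k p → ℤ
  | [] => 0
  | si :: x => (h si.2.1 fun l => (si.2.2 l).bind f) + chainEnergy h (fun i => f (i + 1)) x

lemma sum_eq_chainEnergy (h : Fin p → (Fin k → Option (Fin q)) → ℤ) (f : ℤ → Option (Fin q))
    (x : Config q k p) :
    ∑ j : Fin x.length, (h (x.get j).2.1 fun l => ((x.get j).2.2 l).bind fun a => f (j + a)) =
      chainEnergy h f x := by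
  induction x generalizing f with
  | nil => simp [chainEnergy]
  | cons si x ih =>
    rw [chainEnergy, ← ih]
    simp only [List.length_cons]
    rw [Fin.sum_univ_succ]
    congr 1
    · simp
    · refine Finset.sum_congr rfl fun j _ => ?_
      simp [add_right_comm]

/-- The spins of a configuration as a chain, with missing spins outside of it. -/
def spinChain (x : Config q k p) (i : ℤ) : Option (Fin q) :=
  if 0 ≤ i then (x[i.toNat]?).map Prod.fst else none

lemma energy_eq_chainEnergy (h : Fin p → (Fin k → Option (Fin q)) → ℤ) (x : Config q k p) :
    energy h x = chainEnergy h (spinChain x) x := by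
  rw [← sum_eq_chainEnergy, energy]
  refine Finset.sum_congr rfl fun j _ => congrArg _ (funext fun l => ?_)
  cases (x.get j).2.2 l <;> rfl

lemma Is1DIntSet.finite {S : Set (LocInt k p)} (hS : Is1DIntSet S) : S.Finite := by
  have h : (Set.univ.pi fun _ : Fin k => some '' Set.Icc (-(k : ℤ)) k).Finite :=
    Set.Finite.pi fun _ => (Set.finite_Icc _ _).image _
  refine ((Set.finite_univ (α := Fin p)).prod h).subset fun I hI => ⟨trivial, fun l _ => ?_⟩
  obtain ⟨a, ha, ha'⟩ := hS.2 I hI l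
  exact ⟨a, ha', ha.symm⟩

lemma finite_spinStep (h : Fin p → (Fin k → Option (Fin q)) → ℤ) {S : Set (LocInt k p)}
    (hS : S.Finite) : (spinStep h S).Finite := by
  let W := Set.Icc (-(k : ℤ)) k → Option (Fin q)
  refine ((hS.prod (Set.finite_univ (α := W × Fin q × (Fin k → Option (Fin q)) × W))).image
    fun y => (y.2.1, Symb.spin y.2.2.1 :: encInt y.1, h y.1.1 y.2.2.2.1, y.2.2.2.2)).subset ?_
  rintro _ ⟨f, s, I, hI, -, rfl⟩
  exact ⟨(I, _, s, _, _), ⟨hI, trivial⟩, rfl⟩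

lemma encConfig_cons (si : Fin q × LocInt k p) (x : Config q k p) :
    encConfig (si :: x) = (Symb.spin si.1 :: encInt si.2) ++ encConfig x := by
  simp [encConfig]

lemma run_of_config (h : Fin p → (Fin k → Option (Fin q)) → ℤ) {S : Set (LocInt k p)}
    (x : Config q k p) (hx : ∀ si ∈ x, si.2 ∈ S) (f : ℤ → Option (Fin q))
    (hf : ∀ i : ℕ, i < x.length → f i = (x[i]?).map Prod.fst) :
    Run (spinStep h S) x.length (spinWindow k f) (encConfig x) (chainEnergy h f x)
      (spinWindow k fun i => f (i + x.length)) := by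
  induction x generalizing f with
  | nil => simpa [encConfig, chainEnergy] using Run.nil _
  | cons si x ih =>
    have hrun := ih (fun y hy => hx y (List.mem_cons_of_mem _ hy)) (fun i => f (i + 1))
      fun i hi => by simpa using hf (i + 1) (by simpa using hi)
    have hstep : (spinWindow k f, Symb.spin si.1 :: encInt si.2,
        (h si.2.1 fun l => (si.2.2 l).bind f), spinWindow k fun i => f (i + 1)) ∈ spinStep h S :=
      ⟨f, si.1, si.2, hx si List.mem_cons_self, by simpa using hf 0 (by simp), rfl⟩
    have hlen : (fun i : ℤ => f (i + (si :: x).length)) = fun i : ℤ => f (i + x.length + 1) := by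
      funext i
      rw [List.length_cons, Nat.cast_succ, add_assoc]
    rw [encConfig_cons, chainEnergy, hlen]
    exact Run.cons hstep hrun

lemma exists_config_of_run {h : Fin p → (Fin k → Option (Fin q)) → ℤ} {S : Set (LocInt k p)}
    (hS : Is1DIntSet S) {n : ℕ} {W W' : Set.Icc (-(k : ℤ)) k → Option (Fin q)}
    {w : List (Symb q p)} {z : ℤ} (hrun : Run (spinStep h S) n W w z W')
    (hW' : ∀ l : Set.Icc (-(k : ℤ)) k, 0 ≤ (l : ℤ) → W' l = none) :
    ∃ x : Config q k p, (∀ si ∈ x, si.2 ∈ S) ∧ w = encConfig x ∧ (x = [] → W = W') ∧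
      ∀ f : ℤ → Option (Fin q), (∀ i : ℕ, f i = (x[i]?).map Prod.fst) →
        (∀ l : Set.Icc (-(k : ℤ)) k, (l : ℤ) < 0 → W l = f l) →
          W = spinWindow k f ∧ z = chainEnergy h f x := by
  induction hrun with
  | nil W =>
    refine ⟨[], by simp, rfl, fun _ => rfl, fun f hf hneg => ⟨funext fun l => ?_, rfl⟩⟩
    rcases lt_or_ge (l : ℤ) 0 with hl | hl
    · exact hneg l hl
    · rw [hW' l hl]
      have := hf (l : ℤ).toNat
      rw [Int.toNat_of_nonneg hl] at this
      simp [spinWindow, this]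
  | cons hstep _ ih =>
    obtain ⟨x, hxS, rfl, -, hx⟩ := ih hW'
    obtain ⟨g, s, I, hI, hg, heq⟩ := hstep
    simp only [Prod.mk.injEq] at heq
    obtain ⟨rfl, rfl, rfl, rfl⟩ := heq
    refine ⟨(s, I) :: x, ?_, (encConfig_cons (s, I) x).symm, by simp, fun f hf hneg => ?_⟩
    · rintro si (_ | ⟨_, hsi⟩)
      · exact hI
      · exact hxS si hsi
    have hf₀ : f 0 = some s := by simpa using hf 0
    obtain ⟨h₁, h₂⟩ := hx (fun i => f (i + 1)) (fun i => by simpa using hf (i + 1)) (by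
      rintro ⟨l, hl₁, hl₂⟩ hl
      simp only at hl
      rcases eq_or_ne l (-1) with rfl | hne
      · simp [spinWindow, hg, hf₀]
      · exact hneg ⟨l + 1, by omega, by omega⟩ (by simp only; omega))
    have hwin : spinWindow k g = spinWindow k f := by
      funext ⟨l, hl₁, hl₂⟩
      rcases lt_trichotomy l 0 with hl | rfl | hl
      · exact hneg _ hl
      · exact hg.trans hf₀.symm
      · simpa [spinWindow] using congrFun h₁ ⟨l - 1, by omega, by omega⟩
    refine ⟨hwin, ?_⟩
    rw [h₂, chainEnergy]
    congr 2
    funext l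
    obtain ⟨a, ha, ha'⟩ := hS.2 I hI l
    rw [ha]
    exact congrFun hwin ⟨a, ha'⟩

lemma unary_units_mul (ε : ℤˣ) (n : ℕ) :
    (unary (ε * n) : List (Symb q p)) =
      List.replicate n (if ε = 1 then Symb.dia else Symb.sq) := by
  rcases Int.units_eq_one_or ε with rfl | rfl
  · simp [unary]
  · rcases Nat.eq_zero_or_pos n with rfl | hn
    · simp [unary]
    · rw [unary, if_neg (by simp; omega), if_neg (by decide)]
      simp

end OneD

/-- If `H` is a 1D spin Hamiltonian, then its language `L_H` is a
context-free language. -/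
theorem oneD_contextFree {q k p : ℕ} (hq : 0 < q) (hk : 0 < k) (hp : 0 < p)
    (h : Fin p → (Fin k → Option (Fin q)) → ℤ)
    (S : Set (LocInt k p)) (hS : Is1DIntSet S) :
    (langH h (Domain1D q S)).IsContextFree := by
  have hlang : langH h (Domain1D q S) = WeightedAutomaton.weightLanguage (spinStep h S)
      {W | ∀ l : Set.Icc (-(k : ℤ)) k, (l : ℤ) < 0 → W l = none}
      {W | (∀ l : Set.Icc (-(k : ℤ)) k, 0 ≤ (l : ℤ) → W l = none) ∧
        ∀ l : Set.Icc (-(k : ℤ)) k, (l : ℤ) = -1 → W l ≠ none}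
      (fun ε => if ε = 1 then Symb.dia else Symb.sq) Symb.comp Symb.bullet := by
    ext w
    constructor
    · rintro ⟨x, ⟨hx, hxS⟩, rfl⟩
      have hpos : 0 < x.length := List.length_pos_iff.2 hx
      have hrun := run_of_config h (S := S) x
        (fun si hsi => by obtain ⟨j, rfl⟩ := List.get_of_mem hsi; exact hxS j)
        (spinChain x) (fun i _ => by simp [spinChain])
      rw [← energy_eq_chainEnergy] at hrun
      obtain ⟨ε, hε⟩ : ∃ ε : ℤˣ, energy h x = ε * ((energy h x).natAbs : ℤ) := by
        rcases Int.natAbs_eq (energy h x) with h₀ | h₀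
        · exact ⟨1, by simpa using h₀⟩
        · exact ⟨-1, by simpa using h₀⟩
      refine ⟨_, fun l hl => ?_, _, ⟨fun l hl => ?_, fun l hl => ?_⟩, _, _, ε,
        (energy h x).natAbs, by rwa [← hε], ?_⟩
      · simp [spinWindow, spinChain, hl]
      · rw [spinWindow, spinChain, if_pos (by omega), List.getElem?_eq_none (by omega)]
        rfl
      · rw [spinWindow, spinChain, if_pos (by omega), List.getElem?_eq_getElem (by omega)]
        simp
      · rw [← unary_units_mul, ← hε]
    · rintro ⟨W, hW, W', ⟨hW', hne⟩, n, w, ε, m, hrun, rfl⟩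
      obtain ⟨x, hxS, rfl, hnil, hx⟩ := exists_config_of_run hS hrun hW'
      obtain ⟨-, hz⟩ := hx (spinChain x) (fun i => by simp [spinChain])
        (fun l hl => by rw [hW l hl, spinChain, if_neg (by omega)])
      refine ⟨x, ⟨?_, fun j => hxS _ (List.get_mem x j)⟩, ?_⟩
      · intro hx₀
        have hl : (-1 : ℤ) ∈ Set.Icc (-(k : ℤ)) k := ⟨by omega, by omega⟩
        refine hne ⟨-1, hl⟩ rfl ?_
        rw [← hnil hx₀]
        exact hW ⟨-1, hl⟩ (by simp)
      · rw [energy_eq_chainEnergy, ← hz, unary_units_mul]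
  rw [hlang]
  exact WeightedAutomaton.isContextFree_weightLanguage (finite_spinStep h hS.finite) _ _ _ _ _
end

section
/- Let H be a 1D spin Hamiltonian with a single spin symbol (q = 1) and fixed interactions (𝓘_{1D} = {I} is a singleton). Then the language L_U of its trivial time evolution is not a regular language. -/
/-- The language of the trivial time evolution, `L_U = { e(x) ∘ e(x) • : x ∈ 𝒟 }`. -/
def langU {q k p : ℕ} (D : Set (Config q k p)) : Language (Symb q p) :=
  {w | ∃ x ∈ D, w = encConfig x ++ [Symb.comp] ++ encConfig x ++ [Symb.bullet]}

theorem comp_notMem_encAddr {q p : ℕ} (a : Option ℤ) :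
    (Symb.comp : Symb q p) ∉ encAddr a := by
  cases a with
  | none => simp [encAddr]
  | some z =>
    simp only [encAddr, unary]
    split <;> simp [List.mem_replicate]

theorem notMem_intercalate {α : Type*} {a : α} {sep : List α} {L : List (List α)}
    (hsep : a ∉ sep) (hL : ∀ l ∈ L, a ∉ l) : a ∉ List.intercalate sep L := by
  induction L with
  | nil => simp [List.intercalate]
  | cons b t ih =>
    cases t with
    | nil => simpa [List.intercalate] using hL
    | cons c t => simp_all [List.intercalate]

theorem comp_notMem_encInt {q k p : ℕ} (I : LocInt k p) :
    (Symb.comp : Symb q p) ∉ encInt I := by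
  have := notMem_intercalate (a := (Symb.comp : Symb q p)) (sep := [Symb.blank])
    (L := List.ofFn fun l => encAddr (I.2 l)) (by simp)
    (by simp [List.mem_ofFn, comp_notMem_encAddr])
  simp [encInt, this]

theorem comp_notMem_encConfig {q k p : ℕ} (x : Config q k p) :
    Symb.comp ∉ encConfig x := by
  simp [encConfig, comp_notMem_encInt]

theorem length_encConfig_replicate {q k p : ℕ} (n : ℕ) (si : Fin q × LocInt k p) :
    (encConfig (List.replicate n si)).length = n * ((encInt (q := q) si.2).length + 1) := by
  simp [encConfig]

theorem encConfig_replicate_injective {q k p : ℕ} (si : Fin q × LocInt k p) :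
    Function.Injective fun n => encConfig (List.replicate n si) := by
  intro m n hmn
  have := congrArg List.length hmn
  simpa [length_encConfig_replicate] using this

theorem replicate_mem_Domain1D {k p q : ℕ} (s : Fin q) (I₀ : LocInt k p) (n : ℕ) :
    List.replicate (n + 1) (s, I₀) ∈ Domain1D q {I₀} := by
  simp [Domain1D]

/-- If `H` is a 1D spin Hamiltonian with a single spin symbol (`q = 1`)
and fixed interactions (`𝓘_{1D} = {I₀}`), then the language `L_U` of its trivial time
evolution is not regular. -/
theorem langU_q1_fixed_not_regular {k p : ℕ} (hk : 0 < k) (hp : 0 < p)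
    (h : Fin p → (Fin k → Option (Fin 1)) → ℤ)
    (I₀ : LocInt k p) (hS : Is1DIntSet {I₀}) :
    ¬ (langU (Domain1D 1 {I₀})).IsRegular := by
  intro hreg
  let e : ℕ → List (Symb 1 p) := fun n => encConfig (List.replicate (n + 1) ((0 : Fin 1), I₀))
  have hinj : Function.Injective fun n =>
      (langU (Domain1D 1 {I₀})).leftQuotient (e n ++ [Symb.comp]) := by
    intro m n hmn
    have hn : e n ++ [Symb.bullet] ∈
        (langU (Domain1D 1 {I₀})).leftQuotient (e n ++ [Symb.comp]) :=
      ⟨_, replicate_mem_Domain1D 0 I₀ n, by simp [e]⟩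
    obtain ⟨x, -, hx⟩ := (congrArg (e n ++ [Symb.bullet] ∈ ·) hmn).mpr hn
    simp only [List.append_assoc, List.singleton_append] at hx
    obtain ⟨hm, -, hn⟩ := (List.append_cons_inj_of_notMem (comp_notMem_encConfig _)
      (by simp [comp_notMem_encConfig])).1 hx.symm
    have hmn' : e m = e n := hm.symm.trans (List.append_cancel_right hn)
    exact Nat.succ_injective (encConfig_replicate_injective ((0 : Fin 1), I₀) hmn')
  exact Set.infinite_range_of_injective hinj
    (hreg.finite_range_leftQuotient.subset <| by
      rintro _ ⟨n, rfl⟩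
      exact Set.mem_range_self _)
end

section
/- If H is a dD spin Hamiltonian with d ≥ 2, then the language L_U of its trivial time evolution is not a context-free language. -/
/-- `N_i = n_1 ⋯ n_i` (and `N_0 = 1`), where `nn` lists the side lengths (0-based). -/
def Npart {d : ℕ} (nn : Fin d → ℕ) (i : Fin d) : ℕ := ∏ t ∈ Finset.Iio i, nn t

/-- The `i`-th coordinate `a_i` in the decomposition `j = Σ_i a_i N_i` (`j` 0-based). -/
def coordOf {d : ℕ} (nn : Fin d → ℕ) (j : ℕ) (i : Fin d) : ℕ :=
  (j / Npart nn i) % nn i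

/-- `Z_{n,j}(v) = Σ_i v_i N_i` if `0 ≤ a_i + v_i < n_{i+1}` for all `i`, and ▲ otherwise. -/
def Zfun {d : ℕ} (nn : Fin d → ℕ) (j : ℕ) (v : Fin d → ℤ) : Option ℤ :=
  if ∀ i, 0 ≤ (coordOf nn j i : ℤ) + v i ∧ (coordOf nn j i : ℤ) + v i < (nn i : ℤ)
  then some (∑ i, v i * (Npart nn i : ℤ)) else none

/-- The domain of a dD spin Hamiltonian with base lattice `ℓ` and move set `V`:
configurations whose length is `∏ i (m ℓ_i)` for some `m ≥ 1`, with each local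
interaction of the form `(α, (Z_{n,j}(v^1),…,Z_{n,j}(v^k)))` for some `(α, vs) ∈ V`. -/
def DomainDD {q k p : ℕ} (d : ℕ) (ℓ : Fin d → ℕ)
    (V : Set (Fin p × (Fin k → Fin d → ℤ))) : Set (Config q k p) :=
  {x | ∃ m : ℕ, 1 ≤ m ∧ x.length = ∏ i, m * ℓ i ∧
      ∀ j : Fin x.length, ∃ αv ∈ V,
        (x.get j).2 = (αv.1, fun l => Zfun (fun i => m * ℓ i) (j : ℕ) (αv.2 l))}

namespace ContextFreeGrammar

variable {T : Type*} {g : ContextFreeGrammar T}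

/-- `g.ParsesIn n s w`: the word `w` has a parse forest of size `n` with roots the string `s`. -/
inductive ParsesIn (g : ContextFreeGrammar T) : ℕ → List (Symbol T g.NT) → List T → Prop
  | nil : ParsesIn g 0 [] []
  | terminal (t : T) {n : ℕ} {s : List (Symbol T g.NT)} {w : List T} (h : ParsesIn g n s w) :
      ParsesIn g (n + 1) (.terminal t :: s) (t :: w)
  | nonterminal {r : ContextFreeRule T g.NT} (hr : r ∈ g.rules) {m n : ℕ}
      {s : List (Symbol T g.NT)} {u w : List T}
      (hu : ParsesIn g m r.output u) (hw : ParsesIn g n s w) :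
      ParsesIn g (m + n + 1) (.nonterminal r.input :: s) (u ++ w)

/-- `g.ParsesAvoiding S s w`: the word `w` has a parse forest with roots the string `s` in which no
branch repeats a nonterminal or meets a nonterminal from `S`. -/
inductive ParsesAvoiding (g : ContextFreeGrammar T) :
    Set g.NT → List (Symbol T g.NT) → List T → Prop
  | nil (S : Set g.NT) : ParsesAvoiding g S [] []
  | terminal (t : T) {S : Set g.NT} {s : List (Symbol T g.NT)} {w : List T}
      (h : ParsesAvoiding g S s w) : ParsesAvoiding g S (.terminal t :: s) (t :: w)
  | nonterminal {r : ContextFreeRule T g.NT} (hr : r ∈ g.rules) {S : Set g.NT}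
      (hS : r.input ∉ S) {s : List (Symbol T g.NT)} {u w : List T}
      (hu : ParsesAvoiding g (insert r.input S) r.output u) (hw : ParsesAvoiding g S s w) :
      ParsesAvoiding g S (.nonterminal r.input :: s) (u ++ w)

lemma ParsesIn.exists_of_append {n : ℕ} {a b : List (Symbol T g.NT)} {w : List T}
    (h : g.ParsesIn n (a ++ b) w) :
    ∃ m₁ m₂ u v, w = u ++ v ∧ g.ParsesIn m₁ a u ∧ g.ParsesIn m₂ b v := by
  induction a generalizing n w with
  | nil => exact ⟨0, n, [], w, rfl, .nil, h⟩
  | cons c a ih =>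
    rw [List.cons_append] at h
    cases h with
    | terminal t h =>
      obtain ⟨m₁, m₂, u, v, rfl, hu, hv⟩ := ih h
      exact ⟨_, _, t :: u, v, rfl, .terminal t hu, hv⟩
    | nonterminal hr hx h =>
      obtain ⟨m₁, m₂, u, v, rfl, hu, hv⟩ := ih h
      exact ⟨_, _, _, v, (List.append_assoc ..).symm, .nonterminal hr hx hu, hv⟩

lemma ParsesIn.exists_append {m n : ℕ} {a b : List (Symbol T g.NT)} {u v : List T}
    (hu : g.ParsesIn m a u) (hv : g.ParsesIn n b v) : ∃ l, g.ParsesIn l (a ++ b) (u ++ v) := by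
  induction hu with
  | nil => exact ⟨n, hv⟩
  | terminal t _ ih =>
    obtain ⟨l, hl⟩ := ih
    exact ⟨_, .terminal t hl⟩
  | nonterminal hr hx _ _ ih =>
    obtain ⟨l, hl⟩ := ih
    exact ⟨_, by simpa only [List.append_assoc, List.cons_append] using ParsesIn.nonterminal hr hx hl⟩

lemma exists_parsesIn_map_terminal (w : List T) :
    ∃ n, g.ParsesIn n (w.map Symbol.terminal) w := by
  induction w with
  | nil => exact ⟨0, .nil⟩
  | cons t w ih =>
    obtain ⟨n, hn⟩ := ih
    exact ⟨_, .terminal t hn⟩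

lemma Derives.exists_parsesIn {s : List (Symbol T g.NT)} {w : List T}
    (h : g.Derives s (w.map Symbol.terminal)) : ∃ n, g.ParsesIn n s w := by
  induction h using Relation.ReflTransGen.head_induction_on with
  | refl => exact exists_parsesIn_map_terminal w
  | head hab _ ih =>
    obtain ⟨r, hr, hab⟩ := hab
    obtain ⟨a, b, rfl, rfl⟩ := hab.exists_parts
    obtain ⟨n, hn⟩ := ih
    obtain ⟨_, _, _, v, rfl, hl, hv⟩ := hn.exists_of_append
    obtain ⟨_, _, u, x, rfl, hu, hx⟩ := hl.exists_of_append
    obtain ⟨_, hxv⟩ := (ParsesIn.nonterminal hr hx .nil).exists_append hv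
    obtain ⟨_, h'⟩ := hu.exists_append hxv
    exact ⟨_, by simpa using h'⟩

lemma derives_of_rule {r : ContextFreeRule T g.NT} (hr : r ∈ g.rules)
    (a b : List (Symbol T g.NT)) :
    g.Derives (a ++ [.nonterminal r.input] ++ b) (a ++ r.output ++ b) :=
  Produces.single ⟨r, hr, r.rewrites_of_exists_parts a b⟩

lemma ParsesIn.derives {n : ℕ} {s : List (Symbol T g.NT)} {w : List T}
    (h : g.ParsesIn n s w) : g.Derives s (w.map Symbol.terminal) := by
  induction h with
  | nil => rfl
  | terminal t _ ih => simpa using ih.append_left [.terminal t]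
  | @nonterminal r hr m n s u w _ _ ihu ihw =>
    have h₁ : g.Derives (.nonterminal r.input :: s) (r.output ++ s) := by
      simpa using derives_of_rule hr [] s
    rw [List.map_append]
    exact h₁.trans ((ihu.append_right s).trans (ihw.append_left _))

lemma ParsesAvoiding.append {S : Set g.NT} {a b : List (Symbol T g.NT)} {u v : List T}
    (hu : g.ParsesAvoiding S a u) (hv : g.ParsesAvoiding S b v) :
    g.ParsesAvoiding S (a ++ b) (u ++ v) := by
  induction hu with
  | nil => exact hv
  | terminal t _ ih => exact .terminal t (ih hv)
  | nonterminal hr hS hx _ _ ih =>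
    simpa only [List.append_assoc, List.cons_append] using ParsesAvoiding.nonterminal hr hS hx (ih hv)

lemma finite_setOf_parsesAvoiding (S : Set g.NT) (s : List (Symbol T g.NT)) :
    {w | g.ParsesAvoiding S s w}.Finite := by
  classical
  induction hn : (g.rules.filter (·.input ∉ S)).card using Nat.strong_induction_on
    generalizing S s with
  | _ n ihn =>
  subst hn
  induction s with
  | nil =>
    refine (Set.finite_singleton []).subset fun w hw => ?_
    cases hw
    rfl
  | cons c s ih =>
    cases c with
    | terminal t =>
      refine (ih.image (t :: ·)).subset fun w hw => ?_
      cases hw with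
      | terminal _ h => exact ⟨_, h, rfl⟩
    | nonterminal A =>
      have hfin : (⋃ r ∈ g.rules.filter (·.input ∉ S), Set.image2 (· ++ ·)
          {u | g.ParsesAvoiding (insert r.input S) r.output u}
          {w | g.ParsesAvoiding S s w}).Finite := by
        refine Set.Finite.biUnion (Finset.finite_toSet _) fun r hr => ?_
        have hr' := Finset.mem_filter.1 (Finset.mem_coe.1 hr)
        refine Set.Finite.image2 _ (ihn _ (Finset.card_lt_card ?_) _ _ rfl) ih
        refine Finset.ssubset_iff_subset_ne.2 ⟨fun r' h => ?_, fun h => ?_⟩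
        · simp only [Finset.mem_filter, Set.mem_insert_iff, not_or] at h ⊢
          exact ⟨h.1, h.2.2⟩
        · rw [← h] at hr
          simp at hr
      refine hfin.subset fun w hw => ?_
      cases hw with
      | nonterminal hr hS hu hw =>
        exact Set.mem_biUnion (Finset.mem_coe.2 (Finset.mem_filter.2 ⟨hr, hS⟩)) ⟨_, hu, _, hw, rfl⟩

/-- If no useful nonterminal derives itself with a nonempty terminal context, then a parse forest
either can be pruned so that no branch repeats a nonterminal, or it meets the set `S`. -/
lemma ParsesIn.parsesAvoiding_or
    (hg : ∀ (A : g.NT) (a v x y b : List T),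
      g.Derives [.nonterminal g.initial]
        (a.map .terminal ++ [.nonterminal A] ++ b.map .terminal) →
      g.Derives [.nonterminal A] (v.map .terminal ++ [.nonterminal A] ++ y.map .terminal) →
      g.Derives [.nonterminal A] (x.map .terminal) → v = [] ∧ y = [])
    {n : ℕ} (S : Set g.NT) {s : List (Symbol T g.NT)} {w a b : List T}
    (hs : g.Derives [.nonterminal g.initial] (a.map .terminal ++ s ++ b.map .terminal))
    (h : g.ParsesIn n s w) :
    g.ParsesAvoiding S s w ∨ ∃ A ∈ S, ∃ v x y m, w = v ++ x ++ y ∧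
      g.Derives s (v.map .terminal ++ [.nonterminal A] ++ y.map .terminal) ∧
      g.ParsesIn m [.nonterminal A] x ∧ m ≤ n := by
  induction n using Nat.strong_induction_on generalizing S s w a b with
  | _ n ih =>
  cases h with
  | nil => exact .inl (.nil S)
  | @terminal t n s w h =>
    obtain h' | ⟨A, hA, v, x, y, m, rfl, hd, hx, hm⟩ :=
      ih n (by omega) (a := a ++ [t]) (b := b) S (by simpa using hs) h
    · exact .inl (.terminal t h')
    · exact .inr ⟨A, hA, t :: v, x, y, m, by simp,
        by simpa using hd.append_left [.terminal t], hx, by omega⟩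
  | @nonterminal r hr m n s u w hu hw =>
    have hud := hu.derives
    have hrd : g.Derives [.nonterminal r.input] r.output := by
      simpa using derives_of_rule hr [] []
    have hru := hrd.trans hud
    have hwd := hw.derives
    by_cases hS : r.input ∈ S
    · exact .inr ⟨r.input, hS, [], u, w, m + 0 + 1, by simp,
        by simpa using hwd.append_left [.nonterminal r.input],
        by simpa using ParsesIn.nonterminal hr hu .nil, by omega⟩
    have hA : g.Derives [.nonterminal g.initial]
        (a.map .terminal ++ [.nonterminal r.input] ++ (w ++ b).map .terminal) := by
      refine hs.trans ?_
      have := (hwd.append_left (a.map .terminal ++ [.nonterminal r.input])).append_right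
        (b.map .terminal)
      simpa using this
    have hhead : g.ParsesAvoiding S [.nonterminal r.input] u ∨ ∃ A ∈ S, ∃ v x y m', u = v ++ x ++ y ∧
        g.Derives [.nonterminal r.input] (v.map .terminal ++ [.nonterminal A] ++ y.map .terminal) ∧
        g.ParsesIn m' [.nonterminal A] x ∧ m' ≤ m := by
      obtain h' | ⟨B, hB, v, x, y, m', rfl, hd, hx, hm⟩ :=
        ih m (by omega) (insert r.input S)
          (hA.trans ((hrd.append_left (a.map .terminal)).append_right _)) hu
      · exact .inl (by simpa using ParsesAvoiding.nonterminal hr hS h' (.nil S))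
      · obtain rfl | hB := hB
        · obtain ⟨rfl, rfl⟩ := hg _ _ v _ y _ hA (hrd.trans hd) hru
          obtain h' | ⟨A, hAS, v, x', y, m'', rfl, hd, hx, hm'⟩ := ih m' (by omega) S hA hx
          · exact .inl (by simpa using h')
          · exact .inr ⟨A, hAS, v, x', y, m'', by simp, hd, hx, by omega⟩
        · exact .inr ⟨B, hB, v, x, y, m', rfl, hrd.trans hd, hx, hm⟩
    obtain hhead | ⟨A, hAS, v, x, y, m', rfl, hd, hx, hm⟩ := hhead
    · have hs' : g.Derives [.nonterminal g.initial]
          ((a ++ u).map .terminal ++ s ++ b.map .terminal) := by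
        refine hs.trans ?_
        simpa using (hru.append_left (a.map .terminal)).append_right (s ++ b.map .terminal)
      obtain h' | ⟨A, hAS, v, x, y, m', rfl, hd, hx, hm⟩ := ih n (by omega) S hs' hw
      · exact .inl (hhead.append h')
      · refine .inr ⟨A, hAS, u ++ v, x, y, m', by simp, ?_, hx, by omega⟩
        have := (hru.append_right s).trans (hd.append_left _)
        simpa using this
    · refine .inr ⟨A, hAS, v, x, y ++ w, m', by simp, ?_, hx, by omega⟩
      have := (hd.append_right s).trans (hwd.append_left _)
      simpa using this

lemma derives_pump {A : g.NT} {v x y : List T}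
    (hA : g.Derives [.nonterminal A] (v.map .terminal ++ [.nonterminal A] ++ y.map .terminal))
    (hx : g.Derives [.nonterminal A] (x.map .terminal)) (i : ℕ) :
    g.Derives [.nonterminal A] (((List.replicate i v).flatten ++ x ++
      (List.replicate i y).flatten).map .terminal) := by
  induction i with
  | zero => simpa using hx
  | succ i ih =>
    have := hA.trans ((ih.append_left (v.map .terminal)).append_right (y.map .terminal))
    rw [List.replicate_succ, List.replicate_succ']
    simpa using this

end ContextFreeGrammar

/-- The pumping lemma for context-free languages, without bounds on the lengths of the parts. -/
theorem Language.IsContextFree.exists_pump_of_infinite {T : Type*} {L : Language T}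
    (hL : L.IsContextFree) (hinf : Set.Infinite (L : Set (List T))) :
    ∃ a v x y b : List T, ¬ (v = [] ∧ y = []) ∧
      ∀ i : ℕ, a ++ ((List.replicate i v).flatten ++ x ++ (List.replicate i y).flatten) ++ b ∈ L := by
  obtain ⟨g, rfl⟩ := hL
  by_contra! hcon
  refine hinf ((ContextFreeGrammar.finite_setOf_parsesAvoiding (g := g) ∅
    [.nonterminal g.initial]).subset fun w hw => ?_)
  obtain ⟨n, hn⟩ := ContextFreeGrammar.Derives.exists_parsesIn hw
  have h := hn.parsesAvoiding_or (a := []) (b := []) (fun A a v x y b ha hA hx => ?_) ∅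
    (by simpa using Relation.ReflTransGen.refl)
  · simpa using h
  · by_contra hvy
    obtain ⟨i, hi⟩ := hcon a v x y b (by tauto)
    refine hi ?_
    rw [ContextFreeGrammar.mem_language_iff]
    have := ha.trans (((ContextFreeGrammar.derives_pump hA hx i).append_left
      (a.map .terminal)).append_right (b.map .terminal))
    simpa using this

lemma count_rhd_encAddr {q p : ℕ} (a : Option ℤ) :
    (encAddr (q := q) (p := p) a).count .rhd = 0 := by
  rw [List.count_eq_zero]
  cases a with
  | none => simp [encAddr]
  | some z =>
    simp only [encAddr, unary]
    split_ifs <;> simp [List.mem_replicate]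

lemma List.count_intercalate_eq_zero {α : Type*} [DecidableEq α] {a : α} {s : List α}
    {l : List (List α)} (hs : s.count a = 0) (hl : ∀ x ∈ l, x.count a = 0) :
    (s.intercalate l).count a = 0 := by
  induction l with
  | nil => simp
  | cons x l ih =>
    have hx := hl x (by simp)
    have ih' := ih fun y hy => hl y (by simp [hy])
    cases l with
    | nil => simpa using hx
    | cons y l =>
      rw [List.intercalate_cons_cons, List.count_append, List.count_append, hx, hs, ih']

lemma count_rhd_encInt {q k p : ℕ} (I : LocInt k p) :
    (encInt (q := q) I).count .rhd = 1 := by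
  have h : (List.intercalate [Symb.blank]
      (List.ofFn fun l => encAddr (q := q) (p := p) (I.2 l))).count .rhd = 0 := by
    refine List.count_intercalate_eq_zero (by simp) fun x hx => ?_
    obtain ⟨l, rfl⟩ := (List.mem_ofFn' ..).1 hx
    exact count_rhd_encAddr _
  simp [encInt, h]

lemma count_rhd_encConfig {q k p : ℕ} (x : Config q k p) :
    (encConfig x).count .rhd = x.length := by
  induction x with
  | nil => simp [encConfig]
  | cons c x ih =>
    have h : encConfig (c :: x) = Symb.spin c.1 :: encInt c.2 ++ encConfig x := by
      simp [encConfig]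
    rw [h, List.count_append, ih, List.count_cons, count_rhd_encInt]
    simp [add_comm]

/-- The word of the trivial time evolution on the configuration `x`. -/
def wordU {q k p : ℕ} (x : Config q k p) : List (Symb q p) :=
  encConfig x ++ [Symb.comp] ++ encConfig x ++ [Symb.bullet]

lemma count_rhd_wordU {q k p : ℕ} (x : Config q k p) :
    (wordU x).count .rhd = 2 * x.length := by
  simp [wordU, count_rhd_encConfig, two_mul]

lemma mul_add_le_prod_succ_mul {d : ℕ} (hd : 2 ≤ d) {ℓ : Fin d → ℕ} (hℓ : ∀ i, 0 < ℓ i) (m : ℕ) :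
    ∏ i, m * ℓ i + (m + 1) ≤ ∏ i, (m + 1) * ℓ i := by
  obtain ⟨e, rfl⟩ : ∃ e, d = e + 2 := ⟨d - 2, by omega⟩
  simp only [Finset.prod_mul_distrib, Finset.prod_const, Finset.card_univ, Fintype.card_fin]
  have hP : 1 ≤ ∏ i, ℓ i := Finset.prod_pos fun i _ => hℓ i
  have h₁ : m ^ (e + 1) ≤ (m + 1) ^ (e + 1) := Nat.pow_le_pow_left (by omega) _
  have h₂ : m + 1 ≤ (m + 1) ^ (e + 1) := Nat.le_self_pow (by omega) _
  have h₃ : m ^ (e + 2) + (m + 1) ≤ (m + 1) ^ (e + 2) := by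
    rw [pow_succ m, pow_succ (m + 1) (e + 1)]
    nlinarith
  nlinarith

lemma strictMono_prod_mul {d : ℕ} (hd : 2 ≤ d) {ℓ : Fin d → ℕ} (hℓ : ∀ i, 0 < ℓ i) :
    StrictMono fun m : ℕ => ∏ i, m * ℓ i :=
  strictMono_nat_of_lt_succ fun m => by
    have := mul_add_le_prod_succ_mul hd hℓ m
    omega

lemma finite_moves {k p d : ℕ} {V : Set (Fin p × (Fin k → Fin d → ℤ))}
    (hVk : ∀ αv ∈ V, ∀ l : Fin k, ∑ i, (αv.2 l i).natAbs ≤ k) : V.Finite := by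
  have hfin : (Set.univ ×ˢ Set.univ.pi fun _ => Set.univ.pi fun _ => Set.Icc (-(k : ℤ)) k :
      Set (Fin p × (Fin k → Fin d → ℤ))).Finite :=
    Set.finite_univ.prod (Set.Finite.pi fun _ => Set.Finite.pi fun _ => Set.finite_Icc _ _)
  refine hfin.subset fun αv h => ⟨trivial, fun l _ i _ => ?_⟩
  have h₁ := hVk αv h l
  have h₂ := Finset.single_le_sum (f := fun i => (αv.2 l i).natAbs) (fun _ _ => Nat.zero_le _)
    (Finset.mem_univ i)
  simp only [Set.mem_Icc]
  omega

/-- The configuration on the `d`-dimensional lattice of scale `m` with given spins and moves. -/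
def latticeConfig {q k p d : ℕ} (ℓ : Fin d → ℕ) (V : Set (Fin p × (Fin k → Fin d → ℤ))) (m : ℕ)
    (c : Fin (∏ i, m * ℓ i) → Fin q × V) : Config q k p :=
  List.ofFn fun j => ((c j).1, (c j).2.1.1,
    fun l => Zfun (fun i => m * ℓ i) (j : ℕ) ((c j).2.1.2 l))

lemma mem_DomainDD_iff {q k p d : ℕ} {ℓ : Fin d → ℕ} {V : Set (Fin p × (Fin k → Fin d → ℤ))}
    {x : Config q k p} :
    x ∈ DomainDD d ℓ V ↔ ∃ m, 1 ≤ m ∧ ∃ c, x = latticeConfig ℓ V m c := by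
  constructor
  · rintro ⟨m, hm, hlen, hx⟩
    choose αv hV hαv using hx
    refine ⟨m, hm, fun j => ((x.get (j.cast hlen.symm)).1, ⟨αv (j.cast hlen.symm), hV _⟩), ?_⟩
    refine List.ext_get (by simp [latticeConfig, hlen]) fun i h₁ h₂ => ?_
    have := hαv ⟨i, h₁⟩
    simp only [latticeConfig, List.get_ofFn]
    exact Prod.ext rfl this
  · rintro ⟨m, hm, c, rfl⟩
    refine ⟨m, hm, by simp [latticeConfig], fun j => ?_⟩
    refine ⟨_, (c (j.cast (by simp [latticeConfig]))).2.2, ?_⟩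
    exact congrArg Prod.snd (List.get_ofFn _ j)

lemma length_latticeConfig {q k p d : ℕ} (ℓ : Fin d → ℕ)
    (V : Set (Fin p × (Fin k → Fin d → ℤ))) (m : ℕ) (c : Fin (∏ i, m * ℓ i) → Fin q × V) :
    (latticeConfig ℓ V m c).length = ∏ i, m * ℓ i := by
  simp [latticeConfig]


/-- If `H` is a dD spin Hamiltonian with `d ≥ 2`, then the language
`L_U` of its trivial time evolution is not context-free. -/
theorem langU_dD_not_contextFree {q k p : ℕ} (hq : 0 < q) (hk : 0 < k) (hp : 0 < p)
    (h : Fin p → (Fin k → Option (Fin q)) → ℤ)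
    (d : ℕ) (hd : 2 ≤ d) (ℓ : Fin d → ℕ) (hℓ : ∀ i, 0 < ℓ i)
    (V : Set (Fin p × (Fin k → Fin d → ℤ))) (hV : V.Nonempty)
    (hVk : ∀ αv ∈ V, ∀ l : Fin k, ∑ i, (αv.2 l i).natAbs ≤ k) :
    ¬ (langU (DomainDD (q := q) d ℓ V)).IsContextFree := by
  have hmono := strictMono_prod_mul hd hℓ
  have hmem : ∀ w, w ∈ langU (DomainDD (q := q) d ℓ V) ↔
      ∃ m, 1 ≤ m ∧ ∃ c, w = wordU (latticeConfig (q := q) ℓ V m c) := by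
    intro w
    constructor
    · rintro ⟨x, hx, rfl⟩
      obtain ⟨m, hm, c, rfl⟩ := mem_DomainDD_iff.1 hx
      exact ⟨m, hm, c, rfl⟩
    · rintro ⟨m, hm, c, rfl⟩
      exact ⟨_, mem_DomainDD_iff.2 ⟨m, hm, c, rfl⟩, rfl⟩
  obtain ⟨αv, hαv⟩ := hV
  intro hcf
  have hinf : Set.Infinite (langU (DomainDD (q := q) d ℓ V) : Set (List (Symb q p))) := by
    refine Set.infinite_of_injective_forall_mem
      (f := fun m : ℕ => wordU (latticeConfig ℓ V (m + 1) fun _ => (⟨0, hq⟩, ⟨αv, hαv⟩)))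
      (fun m m' hmm => ?_) fun m => (hmem _).2 ⟨m + 1, by omega, _, rfl⟩
    have h' := congrArg (List.count .rhd) hmm
    simp only [count_rhd_wordU, length_latticeConfig] at h'
    have := hmono.injective (Nat.eq_of_mul_eq_mul_left two_pos h')
    omega
  obtain ⟨a, v, x, y, b, hvy, hpump⟩ := hcf.exists_pump_of_infinite hinf
  choose m hm c hc using fun i => (hmem _).1 (hpump i)
  set B := v.count .rhd + y.count .rhd with hB
  set C := a.count .rhd + x.count .rhd + b.count .rhd with hC
  have hcount : ∀ i, C + i * B = 2 * ∏ t, m i * ℓ t := by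
    intro i
    have h' := congrArg (List.count .rhd) (hc i)
    rw [count_rhd_wordU, length_latticeConfig] at h'
    rw [← h']
    simp only [List.count_append, List.count_flatten, List.map_replicate, List.sum_replicate,
      smul_eq_mul, hB, hC]
    ring
  rcases Nat.eq_zero_or_pos B with hB0 | hB0
  · have hm0 : ∀ i, m i = m 0 := fun i => hmono.injective (by
      have h₁ := hcount i
      have h₂ := hcount 0
      simp only [hB0, mul_zero] at h₁ h₂
      show ∏ t, m i * ℓ t = ∏ t, m 0 * ℓ t
      omega)
    have := (finite_moves hVk).to_subtype
    have hfin := Set.finite_range fun c => wordU (latticeConfig (q := q) ℓ V (m 0) c)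
    refine Set.infinite_of_injective_forall_mem (f := fun i : ℕ =>
      a ++ ((List.replicate i v).flatten ++ x ++ (List.replicate i y).flatten) ++ b)
      (fun i j hij => ?_) (fun i => ?_) hfin
    · have h' := congrArg List.length hij
      simp only [List.length_append, List.length_flatten, List.map_replicate, List.sum_replicate,
        smul_eq_mul] at h'
      have hpos : 0 < v.length + y.length := by
        rw [← List.length_eq_zero_iff, ← List.length_eq_zero_iff] at hvy
        omega
      refine Nat.eq_of_mul_eq_mul_right hpos ?_
      linarith
    · obtain ⟨m', c', hm', hc'⟩ : ∃ m' c', m' = m 0 ∧ _ = wordU (latticeConfig ℓ V m' c') :=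
        ⟨m i, c i, hm0 i, hc i⟩
      subst hm'
      exact ⟨c', hc'.symm⟩
  · have hle : ∀ i, m i ≤ B := by
      intro i
      have h₁ := hcount i
      have h₂ := hcount (i + 1)
      rw [add_mul] at h₂
      have hlt : m i + 1 ≤ m (i + 1) := hmono.lt_iff_lt.1 (by
        show ∏ t, m i * ℓ t < ∏ t, m (i + 1) * ℓ t
        omega)
      have h₃ : ∏ t, (m i + 1) * ℓ t ≤ ∏ t, m (i + 1) * ℓ t := hmono.monotone hlt
      have h₄ := mul_add_le_prod_succ_mul hd hℓ (m i)
      omega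
    have h₁ := hcount (2 * ∏ t, B * ℓ t + 1)
    have h₂ : ∏ t, m (2 * ∏ t, B * ℓ t + 1) * ℓ t ≤ ∏ t, B * ℓ t := hmono.monotone (hle _)
    have h₃ := Nat.le_mul_of_pos_right (2 * ∏ t, B * ℓ t + 1) hB0
    omega
end
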